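/- arXiv:2109.10299 — 5 statements merged into one kernel-verified Lean document; each statement's English description precedes it below -/
import Mathlib

section
/- Let I ⊆ R be an R-homogeneous ideal and let J = φ(I)S be its standardization. Let > be a monomial order on R and >' a monomial order on S compatible with φ (meaning: if m₁, m₂ are monomials of R with m₁ > m₂, then φ(m₁) >' φ(m₂)). Then the initial ideal of J with respect to >' equals the standardization of the initial ideal of I: in_{>'}(J) = φ(in_>(I))S. -/
open MvPolynomial

/-- The standardization map `φ : R = k[x_{ij}] → S = k[w_{ij}, z_{ij}]`, `x_{ij} ↦ w_{ij}z_{ij}`.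
Here the variables of `S` are indexed by `(Fin p × Fin p) ⊕ (Fin p × Fin p)`, where
`Sum.inl (i,j)` is `w_{ij}` and `Sum.inr (i,j)` is `z_{ij}`. -/
noncomputable def stdMap (k : Type*) [CommSemiring k] (p : ℕ) :
    MvPolynomial (Fin p × Fin p) k →ₐ[k]
      MvPolynomial ((Fin p × Fin p) ⊕ (Fin p × Fin p)) k :=
  MvPolynomial.aeval fun q : Fin p × Fin p => X (Sum.inl q) * X (Sum.inr q)

/-- The weight function giving the `ℤ^p ⊕ ℤ^p`-grading of `R = k[x_{ij}]`,
where `deg (x_{ij}) = e_i ⊕ e_j`. -/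
def wtR (p : ℕ) : Fin p × Fin p → (Fin p → ℕ) × (Fin p → ℕ) :=
  fun q => (Pi.single q.1 1, Pi.single q.2 1)

/-- An ideal `I ⊆ R = k[x_{ij}]` is homogeneous with respect to the `ℤ^p ⊕ ℤ^p`-grading
with `deg (x_{ij}) = e_i ⊕ e_j` iff it contains all the multihomogeneous components of
each of its elements. -/
def IsMultigradedHomogeneous {k : Type*} [CommSemiring k] {p : ℕ}
    (I : Ideal (MvPolynomial (Fin p × Fin p) k)) : Prop :=
  ∀ f ∈ I, ∀ d : (Fin p → ℕ) × (Fin p → ℕ),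
    MvPolynomial.weightedHomogeneousComponent (wtR p) d f ∈ I

/-- A monomial order on a polynomial ring with variables indexed by `σ`, given as a
strict total order `lt` on exponent vectors that is compatible with multiplication of
monomials (addition of exponent vectors) and for which the monomial `1` is smallest. -/
structure MonomialTermOrder (σ : Type*) where
  lt : (σ →₀ ℕ) → (σ →₀ ℕ) → Prop
  irrefl : ∀ a, ¬ lt a a
  trans : ∀ a b c, lt a b → lt b c → lt a c
  total : ∀ a b, a ≠ b → lt a b ∨ lt b a
  add_right : ∀ a b c, lt a b → lt (a + c) (b + c)
  one_min : ∀ a, a ≠ 0 → lt 0 a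

/-- `e` is the exponent vector of the leading monomial of `f` with respect to the
monomial order `m` (in particular `f ≠ 0`). -/
def IsLeadingExponent {σ : Type*} {k : Type*} [CommSemiring k]
    (m : MonomialTermOrder σ) (f : MvPolynomial σ k) (e : σ →₀ ℕ) : Prop :=
  e ∈ f.support ∧ ∀ e' ∈ f.support, e' ≠ e → m.lt e' e

/-- The initial ideal `in_>(I)`: the ideal generated by the leading terms of the nonzero
elements of `I`. -/
noncomputable def initialIdeal {σ : Type*} {k : Type*} [CommSemiring k]
    (m : MonomialTermOrder σ) (I : Ideal (MvPolynomial σ k)) : Ideal (MvPolynomial σ k) :=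
  Ideal.span {g | ∃ f ∈ I, ∃ e : σ →₀ ℕ, IsLeadingExponent m f e ∧
    g = MvPolynomial.monomial e (MvPolynomial.coeff e f)}

/-- `φ` sends the monomial with exponent vector `a` to the one with exponent vector
`Finsupp.sumElim a a`. -/
theorem stdMap_monomial {k : Type*} [CommSemiring k] {p : ℕ} (a : (Fin p × Fin p) →₀ ℕ) (c : k) :
    stdMap k p (monomial a c) = monomial (Finsupp.sumElim a a) c := by
  classical
  rw [stdMap, aeval_monomial, monomial_eq (s := Finsupp.sumElim a a), algebraMap_eq]
  congr 1
  rw [Finsupp.prod_fintype _ _ (by simp), Finsupp.prod_fintype _ _ (by simp),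
    Fintype.prod_sum_type, ← Finset.prod_mul_distrib]
  exact Finset.prod_congr rfl fun q _ => by simp [mul_pow]

theorem sumElim_self_injective {σ : Type*} :
    Function.Injective fun a : σ →₀ ℕ => Finsupp.sumElim a a := fun a b h => by
  ext q
  simpa using DFunLike.congr_fun h (Sum.inl q)

theorem coeff_sumElim_stdMap {k : Type*} [CommSemiring k] {p : ℕ} (a : (Fin p × Fin p) →₀ ℕ)
    (g : MvPolynomial (Fin p × Fin p) k) :
    coeff (Finsupp.sumElim a a) (stdMap k p g) = coeff a g := by
  classical
  induction g using MvPolynomial.induction_on' with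
  | monomial b c =>
    rw [stdMap_monomial, coeff_monomial, coeff_monomial]
    exact if_congr sumElim_self_injective.eq_iff rfl rfl
  | add f g hf hg => rw [map_add, coeff_add, coeff_add, hf, hg]

theorem coeff_stdMap_eq_zero {k : Type*} [CommSemiring k] {p : ℕ}
    {e : ((Fin p × Fin p) ⊕ (Fin p × Fin p)) →₀ ℕ} (he : ∀ a, Finsupp.sumElim a a ≠ e)
    (g : MvPolynomial (Fin p × Fin p) k) : coeff e (stdMap k p g) = 0 := by
  classical
  induction g using MvPolynomial.induction_on' with
  | monomial b c => rw [stdMap_monomial, coeff_monomial, if_neg (he b)]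
  | add f g hf hg => rw [map_add, coeff_add, hf, hg, add_zero]

/-- The coefficient of the monomial with exponent vector `u` when an element of `S` is expanded
over `R` along `φ`. -/
noncomputable def stdComponent (k : Type*) [CommSemiring k] {p : ℕ}
    (u : ((Fin p × Fin p) ⊕ (Fin p × Fin p)) →₀ ℕ)
    (f : MvPolynomial ((Fin p × Fin p) ⊕ (Fin p × Fin p)) k) : MvPolynomial (Fin p × Fin p) k :=
  ∑ a ∈ f.support.preimage (fun a => u + Finsupp.sumElim a a)
    ((add_right_injective u).comp sumElim_self_injective).injOn,
    monomial a (coeff (u + Finsupp.sumElim a a) f)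

theorem coeff_stdComponent {k : Type*} [CommSemiring k] {p : ℕ}
    (u : ((Fin p × Fin p) ⊕ (Fin p × Fin p)) →₀ ℕ)
    (f : MvPolynomial ((Fin p × Fin p) ⊕ (Fin p × Fin p)) k) (a : (Fin p × Fin p) →₀ ℕ) :
    coeff a (stdComponent k u f) = coeff (u + Finsupp.sumElim a a) f := by
  classical
  simp only [stdComponent, coeff_sum, coeff_monomial, Finset.sum_ite_eq', Finset.mem_preimage,
    mem_support_iff, ite_not]
  split_ifs with h
  · exact h.symm
  · rfl

theorem stdComponent_add {k : Type*} [CommSemiring k] {p : ℕ}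
    (u : ((Fin p × Fin p) ⊕ (Fin p × Fin p)) →₀ ℕ)
    (f g : MvPolynomial ((Fin p × Fin p) ⊕ (Fin p × Fin p)) k) :
    stdComponent k u (f + g) = stdComponent k u f + stdComponent k u g := by
  ext a
  simp only [coeff_stdComponent, coeff_add]

theorem stdComponent_zero {k : Type*} [CommSemiring k] {p : ℕ}
    (u : ((Fin p × Fin p) ⊕ (Fin p × Fin p)) →₀ ℕ) :
    stdComponent k u 0 = 0 := by
  ext a
  simp only [coeff_stdComponent, coeff_zero]

/-- Components of `φ(I)S` at exponents `u` not divisible by any `w_{ij}z_{ij}` lie in `I`. -/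
theorem stdComponent_mem {k : Type*} [CommSemiring k] {p : ℕ}
    {I : Ideal (MvPolynomial (Fin p × Fin p) k)}
    {u : ((Fin p × Fin p) ⊕ (Fin p × Fin p)) →₀ ℕ}
    (hu : ∀ q, u (Sum.inl q) = 0 ∨ u (Sum.inr q) = 0)
    {f : MvPolynomial ((Fin p × Fin p) ⊕ (Fin p × Fin p)) k}
    (hf : f ∈ Ideal.map (stdMap k p) I) : stdComponent k u f ∈ I := by
  classical
  have key : ∀ g ∈ I, ∀ s, stdComponent k u (s * stdMap k p g) ∈ I := by
    intro g hg s
    induction s using MvPolynomial.induction_on' with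
    | monomial v c =>
      by_cases hv : ∃ b, v = u + Finsupp.sumElim b b
      · obtain ⟨b, rfl⟩ := hv
        have : stdComponent k u (monomial (u + Finsupp.sumElim b b) c * stdMap k p g) =
            monomial b c * g := by
          ext a
          have hle : u + Finsupp.sumElim b b ≤ u + Finsupp.sumElim a a ↔ b ≤ a := by
            simp [Finsupp.le_def]
          have hsub : u + Finsupp.sumElim a a - (u + Finsupp.sumElim b b) =
              Finsupp.sumElim (a - b) (a - b) := by
            ext (q | q) <;> simp [add_tsub_add_eq_tsub_left]
          rw [coeff_stdComponent, coeff_monomial_mul', coeff_monomial_mul', hsub,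
            coeff_sumElim_stdMap]
          exact if_congr hle rfl rfl
        rw [this]
        exact I.mul_mem_left _ hg
      · have : stdComponent k u (monomial v c * stdMap k p g) = 0 := by
          ext a
          rw [coeff_stdComponent, coeff_monomial_mul', coeff_zero]
          split_ifs with hle
          · rw [coeff_stdMap_eq_zero, mul_zero]
            intro b hb
            refine hv ⟨a - b, ?_⟩
            have hb' : Finsupp.sumElim b b + v = u + Finsupp.sumElim a a := by
              rw [hb, tsub_add_cancel_of_le hle]
            have h (q) : b q + v (Sum.inl q) = u (Sum.inl q) + a q ∧
                b q + v (Sum.inr q) = u (Sum.inr q) + a q :=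
              ⟨by simpa using DFunLike.congr_fun hb' (Sum.inl q),
                by simpa using DFunLike.congr_fun hb' (Sum.inr q)⟩
            ext (q | q) <;> simp only [Finsupp.add_apply, Finsupp.sumElim_inl,
              Finsupp.sumElim_inr, Finsupp.tsub_apply] <;>
            · have := h q
              have := hu q
              omega
          · rfl
        rw [this]
        exact I.zero_mem
    | add s t hs ht =>
      rw [add_mul, stdComponent_add]
      exact I.add_mem hs ht
  rw [Ideal.map] at hf
  induction hf using Submodule.closure_induction with
  | zero =>
    rw [stdComponent_zero]
    exact I.zero_mem
  | add f g _ _ hf hg =>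
    rw [stdComponent_add]
    exact I.add_mem hf hg
  | smul_mem s f hf =>
    obtain ⟨g, hg, rfl⟩ := hf
    exact key g hg s

/-- If `>` is a monomial order on `R`, `>'` a monomial order on `S` compatible with `φ`
(note `φ` maps the monomial with exponent vector `a` to the monomial with exponent vector
`Finsupp.sumElim a a`), then `in_{>'}(J) = φ(in_>(I))S` for the standardization `J = φ(I)S`
of an `R`-homogeneous ideal `I`. -/
theorem initialIdeal_standardization (p : ℕ) (hp : 1 ≤ p) (k : Type*) [Field k]
    (I : Ideal (MvPolynomial (Fin p × Fin p) k))
    (hI : IsMultigradedHomogeneous I)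
    (m : MonomialTermOrder (Fin p × Fin p))
    (m' : MonomialTermOrder ((Fin p × Fin p) ⊕ (Fin p × Fin p)))
    (compat : ∀ a b : (Fin p × Fin p) →₀ ℕ, m.lt a b →
      m'.lt (Finsupp.sumElim a a) (Finsupp.sumElim b b)) :
    initialIdeal m' (Ideal.map (stdMap k p) I) =
      Ideal.map (stdMap k p) (initialIdeal m I) := by
  apply le_antisymm
  · refine Ideal.span_le.2 ?_
    rintro _ ⟨f, hf, e, ⟨he, hmax⟩, rfl⟩
    obtain ⟨u, a, hu, rfl⟩ : ∃ (u : ((Fin p × Fin p) ⊕ (Fin p × Fin p)) →₀ ℕ)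
        (a : (Fin p × Fin p) →₀ ℕ), (∀ q, u (Sum.inl q) = 0 ∨ u (Sum.inr q) = 0) ∧
        e = u + Finsupp.sumElim a a := by
      let a : (Fin p × Fin p) →₀ ℕ :=
        Finsupp.equivFunOnFinite.symm fun q => min (e (Sum.inl q)) (e (Sum.inr q))
      have ha (q) : a q = min (e (Sum.inl q)) (e (Sum.inr q)) := rfl
      refine ⟨e - Finsupp.sumElim a a, a, fun q => ?_, ?_⟩
      · simp only [Finsupp.tsub_apply, Finsupp.sumElim_inl, Finsupp.sumElim_inr, ha]
        omega
      · ext (q | q) <;> simp only [Finsupp.add_apply, Finsupp.tsub_apply, Finsupp.sumElim_inl,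
          Finsupp.sumElim_inr, ha] <;> omega
    have hmem : monomial a (coeff (u + Finsupp.sumElim a a) f) ∈ initialIdeal m I := by
      refine Ideal.subset_span ⟨stdComponent k u f, stdComponent_mem hu hf, a, ⟨?_, ?_⟩, ?_⟩
      · rwa [mem_support_iff, coeff_stdComponent, ← mem_support_iff]
      · intro b hb hba
        rw [mem_support_iff, coeff_stdComponent, ← mem_support_iff] at hb
        refine (m.total b a hba).resolve_right fun hlt => ?_
        have h₁ := hmax _ hb fun h => hba (sumElim_self_injective (add_right_injective u h))
        have h₂ := m'.add_right _ _ u (compat _ _ hlt)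
        rw [add_comm _ u, add_comm _ u] at h₂
        exact m'.irrefl _ (m'.trans _ _ _ h₁ h₂)
      · rw [coeff_stdComponent]
    have := Ideal.mul_mem_left _ (monomial u 1) (Ideal.mem_map_of_mem (stdMap k p) hmem)
    rwa [stdMap_monomial, monomial_mul, one_mul] at this
  · rw [initialIdeal, Ideal.map_span, Ideal.span_le]
    rintro _ ⟨_, ⟨g, hg, a, ⟨ha, hmax⟩, rfl⟩, rfl⟩
    refine Ideal.subset_span ⟨stdMap k p g, Ideal.mem_map_of_mem _ hg, Finsupp.sumElim a a,
      ⟨?_, ?_⟩, ?_⟩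
    · rwa [mem_support_iff, coeff_sumElim_stdMap, ← mem_support_iff]
    · intro e he hea
      obtain ⟨b, rfl⟩ : ∃ b, Finsupp.sumElim b b = e := by
        by_contra! h
        exact mem_support_iff.1 he (coeff_stdMap_eq_zero h g)
      rw [mem_support_iff, coeff_sumElim_stdMap, ← mem_support_iff] at he
      exact compat _ _ (hmax b he fun h => hea (by rw [h]))
    · rw [coeff_sumElim_stdMap]
      exact stdMap_monomial _ _
end

section
/- Let I ⊆ R be an R-homogeneous prime ideal such that R/I is Cohen–Macaulay and x_{i,j} ∉ I for all 1 ≤ i, j ≤ p, and let J = φ(I)S be its standardization. Then for every pair (i,j), the element w_{i,j} z_{i,j} is a nonzerodivisor on S/J. -/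
open MvPolynomial

/-- The depth of a local ring: the supremum of the lengths of regular sequences
contained in the maximal ideal. -/
noncomputable def localRingDepth (A : Type*) [CommRing A] [IsLocalRing A] : ℕ∞ :=
  sSup {n : ℕ∞ | ∃ rs : List A, (rs.length : ℕ∞) = n ∧
    (∀ a ∈ rs, a ∈ IsLocalRing.maximalIdeal A) ∧ RingTheory.Sequence.IsRegular A rs}

/-- A (Noetherian) ring `A` is Cohen–Macaulay if for every prime ideal `P` of `A` the
localization `A_P` is a Cohen–Macaulay local ring, i.e. `depth A_P = dim A_P`. -/
def IsCohenMacaulayRing (A : Type*) [CommRing A] : Prop :=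
  ∀ (P : Ideal A) (_ : P.IsPrime),
    (localRingDepth (Localization.AtPrime P) : WithBot ℕ∞) =
      ringKrullDim (Localization.AtPrime P)

namespace Standardization

variable {σ k : Type*}

/-- The exponent `a` on both copies of the variables. -/
noncomputable def double (a : σ →₀ ℕ) : σ ⊕ σ →₀ ℕ :=
  Finsupp.sumElim a a

/-- The exponent of the largest monomial in the products `w_i z_i` dividing a monomial. -/
noncomputable def common (m : σ ⊕ σ →₀ ℕ) : σ →₀ ℕ :=
  m.comapDomain Sum.inl Sum.inl_injective.injOn ⊓ m.comapDomain Sum.inr Sum.inr_injective.injOn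

@[simp] lemma double_inl (a : σ →₀ ℕ) (i : σ) : double a (Sum.inl i) = a i := rfl

@[simp] lemma double_inr (a : σ →₀ ℕ) (i : σ) : double a (Sum.inr i) = a i := rfl

@[simp] lemma common_apply (m : σ ⊕ σ →₀ ℕ) (i : σ) :
    common m i = min (m (Sum.inl i)) (m (Sum.inr i)) := rfl

lemma common_double_add (a : σ →₀ ℕ) (m : σ ⊕ σ →₀ ℕ) :
    common (double a + m) = a + common m := by
  ext i
  simp [Nat.add_min_add_left]

lemma double_common_add (m : σ ⊕ σ →₀ ℕ) : double (common m) + (m - double (common m)) = m := by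
  refine add_tsub_cancel_of_le fun i => ?_
  cases i <;> simp

lemma double_add_sub_common (a : σ →₀ ℕ) (m : σ ⊕ σ →₀ ℕ) :
    double a + m - double (common (double a + m)) = m - double (common m) := by
  ext i
  rw [common_double_add]
  cases i <;> simp <;> omega

variable [CommRing k]

/-- The algebra map `x_i ↦ w_i z_i`. -/
noncomputable def productMap (σ k : Type*) [CommRing k] :
    MvPolynomial σ k →ₐ[k] MvPolynomial (σ ⊕ σ) k :=
  aeval fun i => X (Sum.inl i) * X (Sum.inr i)

lemma productMap_monomial (a : σ →₀ ℕ) (c : k) :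
    productMap σ k (monomial a c) = monomial (double a) c := by
  induction a using Finsupp.induction_linear generalizing c with
  | zero =>
    have h : double (0 : σ →₀ ℕ) = 0 := by ext i; cases i <;> simp
    rw [h]
    exact (productMap σ k).commutes c
  | add f g hf hg =>
    have h : double (f + g) = double f + double g := by ext i; cases i <;> simp
    rw [h, ← mul_one c, ← monomial_mul, ← monomial_mul, map_mul, hf, hg]
  | single i n =>
    have h : double (Finsupp.single i n) =
        Finsupp.single (Sum.inl i) n + Finsupp.single (Sum.inr i) n := by
      classical
      ext j; cases j <;> simp [Finsupp.single_apply]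
    rw [h, ← C_mul_X_pow_eq_monomial, productMap, map_mul, map_pow, aeval_X, mul_pow,
      X_pow_eq_monomial, X_pow_eq_monomial, monomial_mul, one_mul, algHom_C, algebraMap_eq,
      C_mul_monomial, mul_one]

/-- Coordinates of a polynomial in the `w_i, z_i` with respect to the basis over the polynomial
ring in the `w_i z_i` consisting of the monomials divisible by no `w_i z_i`. -/
noncomputable def coords (σ k : Type*) [CommRing k] :
    MvPolynomial (σ ⊕ σ) k →ₗ[k] ((σ ⊕ σ →₀ ℕ) →₀ MvPolynomial σ k) :=
  (basisMonomials (σ ⊕ σ) k).constr k fun m =>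
    Finsupp.single (m - double (common m)) (monomial (common m) 1)

lemma coords_monomial (m : σ ⊕ σ →₀ ℕ) (c : k) :
    coords σ k (monomial m c) =
      Finsupp.single (m - double (common m)) (monomial (common m) c) := by
  have h : monomial m c = c • basisMonomials (σ ⊕ σ) k m := by simp [smul_monomial]
  rw [h, map_smul, coords, Module.Basis.constr_basis, Finsupp.smul_single, smul_monomial,
    smul_eq_mul, mul_one]

lemma coords_productMap_mul (r : MvPolynomial σ k) (s : MvPolynomial (σ ⊕ σ) k) :
    coords σ k (productMap σ k r * s) = r • coords σ k s := by
  induction r using MvPolynomial.induction_on' with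
  | add p q hp hq => rw [map_add, add_mul, map_add, hp, hq, add_smul]
  | monomial a c =>
    induction s using MvPolynomial.induction_on' with
    | add p q hp hq => rw [mul_add, map_add, hp, hq, map_add, smul_add]
    | monomial m d =>
      rw [productMap_monomial, monomial_mul, coords_monomial, coords_monomial,
        double_add_sub_common, common_double_add, Finsupp.smul_single, smul_eq_mul, monomial_mul]

lemma sum_coords (s : MvPolynomial (σ ⊕ σ) k) :
    ((coords σ k s).sum fun b r => productMap σ k r * monomial b 1) = s := by
  induction s using MvPolynomial.induction_on' with
  | add p q hp hq =>
    rw [map_add, Finsupp.sum_add_index' (by simp) (by simp [add_mul]), hp, hq]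
  | monomial m c =>
    rw [coords_monomial, Finsupp.sum_single_index (by simp), productMap_monomial, monomial_mul,
      mul_one, double_common_add]

lemma mem_map_productMap_iff (I : Ideal (MvPolynomial σ k)) (s : MvPolynomial (σ ⊕ σ) k) :
    s ∈ I.map (productMap σ k) ↔ ∀ b, coords σ k s b ∈ I := by
  constructor
  · intro hs b
    obtain ⟨n, c, x, rfl⟩ := Submodule.mem_span_set'.mp hs
    rw [map_sum, Finsupp.finsetSum_apply]
    refine I.sum_mem fun i _ => ?_
    obtain ⟨r, hr, hx⟩ := (x i).2
    rw [← hx, smul_eq_mul, mul_comm, coords_productMap_mul, Finsupp.smul_apply]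
    exact I.mul_mem_right _ hr
  · intro h
    rw [← sum_coords s]
    exact Ideal.sum_mem _ fun b _ => Ideal.mul_mem_right _ _ (Ideal.mem_map_of_mem _ (h b))

lemma mem_map_productMap_of_mul_mem {I : Ideal (MvPolynomial σ k)} (hI : I.IsPrime)
    {r : MvPolynomial σ k} (hr : r ∉ I) {s : MvPolynomial (σ ⊕ σ) k}
    (h : productMap σ k r * s ∈ I.map (productMap σ k)) : s ∈ I.map (productMap σ k) := by
  rw [mem_map_productMap_iff] at h ⊢
  intro b
  have hb := h b
  rw [coords_productMap_mul, Finsupp.smul_apply, smul_eq_mul] at hb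
  exact (hI.mem_or_mem hb).resolve_left hr

end Standardization

/-- If `I ⊆ R` is an `R`-homogeneous prime ideal with `R/I` Cohen–Macaulay such that no
variable `x_{ij}` lies in `I`, then each `w_{ij} z_{ij}` is a nonzerodivisor on `S/J`,
where `J = φ(I)S` is the standardization of `I`. -/
theorem wz_nonZeroDivisor_standardization (p : ℕ) (hp : 1 ≤ p) (k : Type*) [Field k]
    (I : Ideal (MvPolynomial (Fin p × Fin p) k))
    (hI : IsMultigradedHomogeneous I) (hprime : I.IsPrime)
    (hCM : IsCohenMacaulayRing (MvPolynomial (Fin p × Fin p) k ⧸ I))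
    (hvar : ∀ q : Fin p × Fin p, (X q : MvPolynomial (Fin p × Fin p) k) ∉ I) :
    ∀ q : Fin p × Fin p,
      Ideal.Quotient.mk (Ideal.map (stdMap k p) I)
          ((X (Sum.inl q) : MvPolynomial ((Fin p × Fin p) ⊕ (Fin p × Fin p)) k) *
            X (Sum.inr q)) ∈
        nonZeroDivisors (MvPolynomial ((Fin p × Fin p) ⊕ (Fin p × Fin p)) k ⧸
          Ideal.map (stdMap k p) I) := by
  intro q
  rw [mem_nonZeroDivisors_iff_right]
  intro y hy
  obtain ⟨s, rfl⟩ := Ideal.Quotient.mk_surjective y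
  rw [← map_mul, Ideal.Quotient.eq_zero_iff_mem, mul_comm] at hy
  rw [Ideal.Quotient.eq_zero_iff_mem]
  refine Standardization.mem_map_productMap_of_mul_mem hprime (hvar q) ?_
  rw [Standardization.productMap, aeval_X]
  exact hy
end

section
/- Let I ⊆ R be an R-homogeneous prime ideal such that R/I is Cohen–Macaulay and x_{i,j} ∉ I for all 1 ≤ i, j ≤ p. Then the standardization J = φ(I)S is a prime ideal of S. -/
open MvPolynomial

section Standardization

variable {k : Type*} [Field k] {p : ℕ}

/-- The monomial `w^{d⁻} z^{d⁺}` attached to an integer exponent vector `d`. These monomials form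
a basis of `k[w, z]` as a module over `k[x]` through `stdMap`. -/
noncomputable def stdBasisMonomial (k : Type*) [Field k] {p : ℕ} (d : Fin p × Fin p → ℤ) :
    MvPolynomial ((Fin p × Fin p) ⊕ (Fin p × Fin p)) k :=
  ∏ q, (X (Sum.inl q) ^ (-d q).toNat * X (Sum.inr q) ^ (d q).toNat)

/-- The map from `k[w, z]` to Laurent polynomials in `z` over `k[x] ⧸ I` sending `w_q` to
`x_q z_q⁻¹` and `z_q` to `z_q`. -/
noncomputable def toLaurent (I : Ideal (MvPolynomial (Fin p × Fin p) k)) :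
    MvPolynomial ((Fin p × Fin p) ⊕ (Fin p × Fin p)) k →ₐ[k]
      AddMonoidAlgebra (MvPolynomial (Fin p × Fin p) k ⧸ I) (Fin p × Fin p → ℤ) :=
  aeval (Sum.elim
    (fun q => AddMonoidAlgebra.single (-Pi.single q (1 : ℤ)) (Ideal.Quotient.mk I (X q)))
    (fun q => AddMonoidAlgebra.single (Pi.single q (1 : ℤ)) 1))

lemma toLaurent_stdMap (I : Ideal (MvPolynomial (Fin p × Fin p) k))
    (r : MvPolynomial (Fin p × Fin p) k) :
    toLaurent I (stdMap k p r) = AddMonoidAlgebra.single 0 (Ideal.Quotient.mk I r) := by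
  have h : (toLaurent I).comp (stdMap k p) =
      (AddMonoidAlgebra.singleZeroAlgHom (R := k)
        (A := MvPolynomial (Fin p × Fin p) k ⧸ I) (M := Fin p × Fin p → ℤ)).comp
        (Ideal.Quotient.mkₐ k I) := by
    ext q : 1
    simp [toLaurent, stdMap, AddMonoidAlgebra.single_mul_single]
  simpa using DFunLike.congr_fun h r

lemma toLaurent_stdBasisMonomial (I : Ideal (MvPolynomial (Fin p × Fin p) k))
    (d : Fin p × Fin p → ℤ) :
    toLaurent I (stdBasisMonomial k d) =
      AddMonoidAlgebra.single d (Ideal.Quotient.mk I (∏ q, X q ^ (-d q).toNat)) := by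
  have single_prod : ∀ (s : Finset (Fin p × Fin p)) (e : Fin p × Fin p → Fin p × Fin p → ℤ)
      (a : Fin p × Fin p → MvPolynomial (Fin p × Fin p) k ⧸ I),
      ∏ q ∈ s, AddMonoidAlgebra.single (e q) (a q) =
        AddMonoidAlgebra.single (∑ q ∈ s, e q) (∏ q ∈ s, a q) := by
    intro s e a
    induction s using Finset.induction_on with
    | empty => rfl
    | insert q s hq ih =>
      simp only [Finset.prod_insert hq, Finset.sum_insert hq, ih,
        AddMonoidAlgebra.single_mul_single]
  have exponents : ∑ q, ((-d q).toNat • -Pi.single q (1 : ℤ) + (d q).toNat • Pi.single q 1) =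
      d := by
    have (q : Fin p × Fin p) : (-d q).toNat • -Pi.single q (1 : ℤ) +
        (d q).toNat • Pi.single q 1 = (Pi.single q (d q) : Fin p × Fin p → ℤ) := by
      ext i
      rcases eq_or_ne i q with rfl | hi
      · simp
        omega
      · simp [hi]
    simp only [this, Finset.univ_sum_single]
  simp only [stdBasisMonomial, toLaurent, map_prod, map_mul, map_pow, aeval_X, Sum.elim_inl,
    Sum.elim_inr, AddMonoidAlgebra.single_pow, AddMonoidAlgebra.single_mul_single, one_pow,
    mul_one, single_prod, exponents]

lemma exists_eq_sum_stdMap_mul (f : MvPolynomial ((Fin p × Fin p) ⊕ (Fin p × Fin p)) k) :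
    ∃ c : (Fin p × Fin p → ℤ) →₀ MvPolynomial (Fin p × Fin p) k,
      f = c.sum fun d r => stdMap k p r * stdBasisMonomial k d := by
  induction f using MvPolynomial.induction_on' with
  | monomial u a =>
    refine ⟨Finsupp.single (fun q => (u (Sum.inr q) : ℤ) - u (Sum.inl q))
      (C a * ∏ q, X q ^ min (u (Sum.inl q)) (u (Sum.inr q))), ?_⟩
    rw [Finsupp.sum_single_index (by simp), monomial_eq, Finsupp.prod_fintype _ _ (by simp),
      Fintype.prod_sum_type]
    simp only [stdMap, stdBasisMonomial, map_mul, map_prod, map_pow, aeval_X, algHom_C,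
      algebraMap_eq, mul_assoc, ← Finset.prod_mul_distrib]
    congr 1
    refine Finset.prod_congr rfl fun q _ => ?_
    rw [mul_pow, mul_mul_mul_comm, ← pow_add, ← pow_add]
    congr 2 <;> omega
  | add f g hf hg =>
    obtain ⟨c, rfl⟩ := hf
    obtain ⟨c', rfl⟩ := hg
    refine ⟨c + c', (Finsupp.sum_add_index' (by simp) ?_).symm⟩
    intro d r r'
    rw [map_add, add_mul]

lemma map_stdMap_eq_ker_toLaurent (I : Ideal (MvPolynomial (Fin p × Fin p) k)) [I.IsPrime]
    (hvar : ∀ q : Fin p × Fin p, (X q : MvPolynomial (Fin p × Fin p) k) ∉ I) :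
    I.map (stdMap k p) = RingHom.ker (toLaurent I) := by
  apply le_antisymm
  · rw [Ideal.map_le_iff_le_comap]
    intro r hr
    simp [RingHom.mem_ker, toLaurent_stdMap, Ideal.Quotient.eq_zero_iff_mem.mpr hr]
  · intro f hf
    obtain ⟨c, rfl⟩ := exists_eq_sum_stdMap_mul f
    refine Ideal.sum_mem _ fun d hc => Ideal.mul_mem_right _ _ (Ideal.mem_map_of_mem _ ?_)
    have hmem : c d * ∏ q, X q ^ (-d q).toNat ∈ I := by
      rw [RingHom.mem_ker, Finsupp.sum, map_sum] at hf
      simp only [map_mul, toLaurent_stdMap, toLaurent_stdBasisMonomial,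
        AddMonoidAlgebra.single_mul_single, zero_add] at hf
      have hd := congrArg (fun g => g.coeff d) hf
      simpa [Finsupp.finsetSum_apply, Finsupp.single_apply, ← map_prod, ← map_pow, ← map_mul,
        Ideal.Quotient.eq_zero_iff_mem, Finsupp.mem_support_iff.mp hc] using hd
    refine (Ideal.IsPrime.mem_or_mem ‹_› hmem).resolve_right fun h => ?_
    obtain ⟨q, -, hq⟩ := (Ideal.IsPrime.prod_mem_iff).mp h
    exact hvar q (Ideal.IsPrime.mem_of_pow_mem ‹_› _ hq)

end Standardization

/-- If `I ⊆ R` is an `R`-homogeneous prime ideal with `R/I` Cohen–Macaulay such that no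
variable `x_{ij}` lies in `I`, then the standardization `J = φ(I)S` is a prime ideal. -/
theorem standardization_isPrime (p : ℕ) (hp : 1 ≤ p) (k : Type*) [Field k]
    (I : Ideal (MvPolynomial (Fin p × Fin p) k))
    (hI : IsMultigradedHomogeneous I) (hprime : I.IsPrime)
    (hCM : IsCohenMacaulayRing (MvPolynomial (Fin p × Fin p) k ⧸ I))
    (hvar : ∀ q : Fin p × Fin p, (X q : MvPolynomial (Fin p × Fin p) k) ∉ I) :
    (Ideal.map (stdMap k p) I).IsPrime := by
  rw [map_stdMap_eq_ker_toLaurent I hvar]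
  exact RingHom.ker_isPrime _
end

section
/- Let I ⊆ R be a prime ideal and let B = S[z_{i,j}^{-1} : 1 ≤ i,j ≤ p] be the localization of S at the multiplicative set generated by all the variables z_{i,j}. Then the extension φ(I)B of φ(I) to B is a prime ideal of B. (Indeed, the B-algebra automorphism ψ of B determined by ψ(w_{i,j}) = w_{i,j} z_{i,j}^{-1} and ψ(z_{i,j}) = z_{i,j} maps φ(I)B onto the extension of I under the homomorphism R → B, x_{i,j} ↦ w_{i,j}, whose quotient is the domain (R/I)[z_{i,j}^{±1}].) -/
open MvPolynomial

/-- The multiplicative set of `S` generated by the variables `z_{ij}`. -/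
noncomputable def zMonoid (k : Type*) [CommSemiring k] (p : ℕ) :
    Submonoid (MvPolynomial ((Fin p × Fin p) ⊕ (Fin p × Fin p)) k) :=
  Submonoid.closure
    (Set.range fun q : Fin p × Fin p =>
      (X (Sum.inr q) : MvPolynomial ((Fin p × Fin p) ⊕ (Fin p × Fin p)) k))

namespace MvPolynomial

/-- The extension of a prime ideal to a polynomial ring in further variables is prime. -/
theorem isPrime_map_C {R σ : Type*} [CommRing R] (I : Ideal R) [I.IsPrime] :
    (I.map (C : R →+* MvPolynomial σ R)).IsPrime := by
  rw [← Ideal.Quotient.isDomain_iff_prime]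
  exact (quotientEquivQuotientMvPolynomial (σ := σ) I).symm.toMulEquiv.isDomain _

/-- Extending a prime ideal along the inclusion of polynomial rings given by the left summand of
the variables yields a prime ideal. -/
theorem isPrime_map_rename_inl {R σ τ : Type*} [CommRing R] (I : Ideal (MvPolynomial σ R))
    [I.IsPrime] :
    (I.map (rename (R := R) (Sum.inl : σ → σ ⊕ τ))).IsPrime := by
  let e : MvPolynomial τ (MvPolynomial σ R) ≃ₐ[R] MvPolynomial (σ ⊕ τ) R :=
    (sumAlgEquiv R τ σ).symm.trans (renameEquiv R (Equiv.sumComm τ σ))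
  have he : e.toAlgHom.toRingHom.comp C = (rename (R := R) (Sum.inl : σ → σ ⊕ τ)).toRingHom := by
    ext <;> simp [e]
  have hmap : (I.map C).map e.toAlgHom.toRingHom =
      I.map (rename (R := R) (Sum.inl : σ → σ ⊕ τ)).toRingHom := by
    rw [Ideal.map_map, he]
  have := isPrime_map_C (σ := τ) I
  have hprime : ((I.map C).map e).IsPrime := Ideal.map_isPrime_of_equiv e
  exact hmap ▸ hprime

end MvPolynomial

section Standardization

variable {k : Type*} [Field k] {p : ℕ}

theorem X_inr_mem_zMonoid (q : Fin p × Fin p) :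
    (X (Sum.inr q) : MvPolynomial _ k) ∈ zMonoid k p :=
  Submonoid.subset_closure ⟨q, rfl⟩

/-- The variable `z_q` as a unit of the localization `S[z⁻¹]`. -/
noncomputable def zUnit (k : Type*) [Field k] {p : ℕ} (q : Fin p × Fin p) :
    (Localization (zMonoid k p))ˣ :=
  (IsLocalization.map_units (Localization (zMonoid k p))
    (⟨X (Sum.inr q), X_inr_mem_zMonoid q⟩ : zMonoid k p)).unit

theorem coe_zUnit (k : Type*) [Field k] {p : ℕ} (q : Fin p × Fin p) :
    (zUnit k q : Localization (zMonoid k p)) =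
      algebraMap (MvPolynomial ((Fin p × Fin p) ⊕ (Fin p × Fin p)) k) _ (X (Sum.inr q)) := rfl

/-- The endomorphism of `S[z⁻¹]` fixing each `z_q` and scaling each `w_q` by `c q`, on `S`. -/
noncomputable def wScaleAux (c : Fin p × Fin p → Localization (zMonoid k p)) :
    MvPolynomial ((Fin p × Fin p) ⊕ (Fin p × Fin p)) k →ₐ[k] Localization (zMonoid k p) :=
  aeval (Sum.elim (fun q =>
    algebraMap (MvPolynomial ((Fin p × Fin p) ⊕ (Fin p × Fin p)) k) _ (X (Sum.inl q)) * c q)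
    (fun q => (zUnit k q).val))

theorem isUnit_wScaleAux (c : Fin p × Fin p → Localization (zMonoid k p)) (y : zMonoid k p) :
    IsUnit (wScaleAux c y) := by
  have h : zMonoid k p ≤ (IsUnit.submonoid _).comap (wScaleAux c) := by
    refine Submonoid.closure_le.2 ?_
    rintro _ ⟨q, rfl⟩
    simp [wScaleAux, IsUnit.mem_submonoid_iff]
  exact h y.2

/-- The endomorphism of `S[z⁻¹]` fixing each `z_q` and scaling each `w_q` by `c q`. -/
noncomputable def wScale (c : Fin p × Fin p → Localization (zMonoid k p)) :
    Localization (zMonoid k p) →ₐ[k] Localization (zMonoid k p) :=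
  IsLocalization.liftAlgHom (M := zMonoid k p) (isUnit_wScaleAux c)

@[simp]
theorem wScale_algebraMap (c : Fin p × Fin p → Localization (zMonoid k p))
    (f : MvPolynomial ((Fin p × Fin p) ⊕ (Fin p × Fin p)) k) :
    wScale c (algebraMap _ _ f) = wScaleAux c f := by
  simp only [wScale, IsLocalization.liftAlgHom_apply]
  exact IsLocalization.lift_eq _ f

@[simp]
theorem wScale_zUnit (c : Fin p × Fin p → Localization (zMonoid k p)) (q : Fin p × Fin p) :
    wScale c (zUnit k q).val = zUnit k q := by
  rw [coe_zUnit, wScale_algebraMap]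
  simp [wScaleAux, coe_zUnit]

@[simp]
theorem wScale_zUnit_inv (c : Fin p × Fin p → Localization (zMonoid k p)) (q : Fin p × Fin p) :
    wScale c (zUnit k q)⁻¹.val = (zUnit k q)⁻¹.val := by
  have h : Units.map (wScale c : _ →* Localization (zMonoid k p)) (zUnit k q) = zUnit k q :=
    Units.ext (wScale_zUnit c q)
  simpa using congrArg (fun u => (u⁻¹).val) h

theorem wScale_comp_wScale {c d : Fin p × Fin p → Localization (zMonoid k p)}
    (hd : ∀ q, wScale c (d q) = d q) (hcd : ∀ q, c q * d q = 1) :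
    (wScale c).comp (wScale d) = AlgHom.id k _ := by
  apply AlgHom.coe_ringHom_injective
  apply IsLocalization.ringHom_ext (zMonoid k p)
  apply MvPolynomial.ringHom_ext
  · intro r
    simp [wScaleAux, IsScalarTower.algebraMap_apply k
      (MvPolynomial ((Fin p × Fin p) ⊕ (Fin p × Fin p)) k) (Localization (zMonoid k p)),
      MvPolynomial.algebraMap_eq]
  · rintro (q | q)
    · simp [wScaleAux, hd, mul_assoc, hcd]
    · simp [wScaleAux, coe_zUnit]

/-- The automorphism of `S[z⁻¹]` with `w_q ↦ w_q z_q` and `z_q ↦ z_q`. -/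
noncomputable def wScaleEquiv (k : Type*) [Field k] (p : ℕ) :
    Localization (zMonoid k p) ≃ₐ[k] Localization (zMonoid k p) :=
  AlgEquiv.ofAlgHom (wScale fun q => (zUnit k q).val) (wScale fun q => (zUnit k q)⁻¹.val)
    (wScale_comp_wScale (by simp) (by simp)) (wScale_comp_wScale (by simp) (by simp))

theorem disjoint_zMonoid_map_rename_inl (I : Ideal (MvPolynomial (Fin p × Fin p) k))
    (hI : I ≠ ⊤) :
    Disjoint (zMonoid k p : Set (MvPolynomial ((Fin p × Fin p) ⊕ (Fin p × Fin p)) k))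
      (I.map (rename (R := k) (Sum.inl : Fin p × Fin p → (Fin p × Fin p) ⊕ (Fin p × Fin p)))) := by
  let ε : MvPolynomial ((Fin p × Fin p) ⊕ (Fin p × Fin p)) k →ₐ[k]
      MvPolynomial (Fin p × Fin p) k := aeval (Sum.elim X 1)
  have hz : zMonoid k p ≤ MonoidHom.mker (ε : _ →* MvPolynomial (Fin p × Fin p) k) := by
    refine Submonoid.closure_le.2 ?_
    rintro _ ⟨q, rfl⟩
    simp [ε, MonoidHom.mem_mker]
  have hmap : I.map (rename (R := k)
      (Sum.inl : Fin p × Fin p → (Fin p × Fin p) ⊕ (Fin p × Fin p))) ≤ I.comap ε := by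
    refine Ideal.map_le_iff_le_comap.2 fun f hf => ?_
    have h : ε (rename Sum.inl f) = f := by
      exact (aeval_rename _ _ _).trans (aeval_X_left_apply f)
    simpa [Ideal.mem_comap, h] using hf
  refine Set.disjoint_left.2 fun f hf hfI => hI ((Ideal.eq_top_iff_one I).2 ?_)
  have h1 : ε f = 1 := hz hf
  exact h1 ▸ hmap hfI

theorem wScaleEquiv_comp_rename_inl :
    ((wScaleEquiv k p).toAlgHom.toRingHom.comp (algebraMap _ _)).comp
        (rename (R := k)
          (Sum.inl : Fin p × Fin p → (Fin p × Fin p) ⊕ (Fin p × Fin p))).toRingHom =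
      (algebraMap _ (Localization (zMonoid k p))).comp (stdMap k p).toRingHom := by
  apply MvPolynomial.ringHom_ext
  · intro r
    simp [wScaleEquiv, wScaleAux, stdMap, IsScalarTower.algebraMap_apply k
      (MvPolynomial ((Fin p × Fin p) ⊕ (Fin p × Fin p)) k) (Localization (zMonoid k p)),
      MvPolynomial.algebraMap_eq]
  · intro q
    simp [wScaleEquiv, wScaleAux, stdMap, coe_zUnit]

end Standardization

/-- If `I ⊆ R` is a prime ideal, then the extension `φ(I)B` of `φ(I)` to the
localization `B = S[z_{ij}^{-1}]` of `S` inverting all the variables `z_{ij}` is a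
prime ideal of `B`. -/
theorem standardization_localized_isPrime (p : ℕ) (hp : 1 ≤ p) (k : Type*) [Field k]
    (I : Ideal (MvPolynomial (Fin p × Fin p) k)) (hprime : I.IsPrime) :
    (Ideal.map (algebraMap (MvPolynomial ((Fin p × Fin p) ⊕ (Fin p × Fin p)) k)
        (Localization (zMonoid k p)))
      (Ideal.map (stdMap k p) I)).IsPrime := by
  have := isPrime_map_rename_inl (τ := Fin p × Fin p) I
  have hJ := IsLocalization.isPrime_of_isPrime_disjoint (zMonoid k p)
    (Localization (zMonoid k p)) _ this (disjoint_zMonoid_map_rename_inl I hprime.ne_top)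
  have hK := @Ideal.map_isPrime_of_equiv _ _ _ _ _ _ _ (wScaleEquiv k p) _ hJ
  have hmap := congrArg (fun g => I.map g) (wScaleEquiv_comp_rename_inl (k := k) (p := p))
  simp only [← Ideal.map_map] at hmap
  exact hmap ▸ hK
end

section
/- Let L ⊆ [p] × [p] be a finite set of index pairs and consider g = ∏_{(i,j) ∈ L} (t_i + s_j) ∈ ℤ[t_1,…,t_p,s_1,…,s_p]. Then the Newton polytope of g equals the set of points (r, c) ∈ ℝ_{≥0}^p × ℝ_{≥0}^p satisfying: Σ_{j∈[p]} r_j + Σ_{j∈[p]} c_j = |L|, and for all subsets J₁, J₂ ⊆ [p], Σ_{i∈J₁} r_i + Σ_{j∈J₂} c_j ≥ |{(i,j) ∈ L : i ∈ J₁ and j ∈ J₂}|. Moreover supp(g) consists exactly of the lattice points of this polytope, so supp(g) is a discrete polymatroid on [2p]. -/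
open MvPolynomial

/-- A set `P ⊆ ℕ^σ` is a discrete polymatroid if it is the set of points
`x` with `∑_{j ∈ J} x j ≤ r J` for all proper subsets `J` and `∑ x = r univ`,
for some rank function `r` (normalized, monotone and submodular). -/
def IsDiscretePolymatroid {σ : Type*} [Fintype σ] [DecidableEq σ] (P : Set (σ → ℕ)) : Prop :=
  ∃ r : Finset σ → ℕ,
    r ∅ = 0 ∧
    (∀ J₁ J₂ : Finset σ, J₁ ⊆ J₂ → r J₁ ≤ r J₂) ∧
    (∀ J₁ J₂ : Finset σ, r (J₁ ∩ J₂) + r (J₁ ∪ J₂) ≤ r J₁ + r J₂) ∧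
    P = {x | (∀ J : Finset σ, J ⊂ Finset.univ → ∑ j ∈ J, x j ≤ r J) ∧
              ∑ i, x i = r Finset.univ}

section Orientation

open Finset

variable {ι σ : Type*} [DecidableEq σ]

theorem sum_min_le_sum_mul [Fintype σ] (s : Finset ι) (a b : ι → σ) (y : σ → ℝ)
    (hy : ∑ v, y v = #s)
    (hJ : ∀ J : Finset σ, (#{i ∈ s | a i ∈ J ∧ b i ∈ J} : ℝ) ≤ ∑ v ∈ J, y v) (w : σ → ℝ) :
    ∑ i ∈ s, min (w (a i)) (w (b i)) ≤ ∑ v, w v * y v := by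
  suffices H : ∀ (T : Finset ℝ) (w : σ → ℝ), (∀ v, w v ∈ T) →
      ∑ i ∈ s, min (w (a i)) (w (b i)) ≤ ∑ v, w v * y v from
    H (univ.image w) w fun v => Finset.mem_image_of_mem w (mem_univ v)
  intro T
  induction T using Finset.induction_on_max with
  | empty =>
    intro w hw
    have : IsEmpty σ := ⟨fun v => by simpa using hw v⟩
    have : IsEmpty ι := ⟨fun i => this.elim (a i)⟩
    simp [Finset.eq_empty_of_isEmpty s]
  | insert M T hM ih =>
    intro w hw
    rcases T.eq_empty_or_nonempty with rfl | hT
    · have hw' : w = fun _ => M := by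
        ext v
        simpa using hw v
      simp [hw', ← Finset.mul_sum, hy, mul_comm]
    · have hlt : T.max' hT < M := hM _ (T.max'_mem hT)
      set M' := T.max' hT
      let w' : σ → ℝ := fun v => min (w v) M'
      let J : Finset σ := {v | w v = M}
      have hcases (v : σ) : (v ∈ J ∧ w v = M ∧ w' v = M') ∨
          (v ∉ J ∧ w v ≤ M' ∧ w' v = w v ∧ w v ∈ T) := by
        rcases Finset.mem_insert.1 (hw v) with h | h
        · exact Or.inl ⟨by simp [J, h], h, by simp [w', h, hlt.le]⟩
        · have h' : w v ≤ M' := T.le_max' _ h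
          exact Or.inr ⟨by simp [J, (hM _ h).ne], h', min_eq_left h', h⟩
      have hw' (v : σ) : w' v ∈ T := by
        rcases hcases v with ⟨_, _, h⟩ | ⟨_, _, h, h'⟩
        · rw [h]; exact T.max'_mem hT
        · rwa [h]
      have hwv (v : σ) : w v = w' v + (M - M') * if v ∈ J then 1 else 0 := by
        rcases hcases v with ⟨h1, h2, h3⟩ | ⟨h1, h2, h3, _⟩ <;> simp [h1, h2, h3]
      have hmin (i : ι) : min (w (a i)) (w (b i)) = min (w' (a i)) (w' (b i)) +
          (M - M') * if a i ∈ J ∧ b i ∈ J then 1 else 0 := by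
        rcases hcases (a i) with ⟨h1, h2, h3⟩ | ⟨h1, h2, h3, _⟩ <;>
        rcases hcases (b i) with ⟨k1, k2, k3⟩ | ⟨k1, k2, k3, _⟩ <;>
        simp only [h1, k1, h3, k3, and_self, and_true, and_false, if_true, if_false, mul_one,
          mul_zero, add_zero]
        · rw [h2, k2]; simp
        · rw [h2, min_eq_right k2, min_eq_right (k2.trans hlt.le)]
        · rw [k2, min_eq_left h2, min_eq_left (h2.trans hlt.le)]
      have hright : ∑ v, w v * y v = ∑ v, w' v * y v + (M - M') * ∑ v ∈ J, y v := by
        rw [← Finset.univ_inter J, ← Finset.sum_ite_mem, Finset.mul_sum, ← Finset.sum_add_distrib]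
        refine Finset.sum_congr rfl fun v _ => ?_
        rw [hwv v]
        split_ifs <;> ring
      have hleft : ∑ i ∈ s, min (w (a i)) (w (b i)) = ∑ i ∈ s, min (w' (a i)) (w' (b i)) +
          (M - M') * (#{i ∈ s | a i ∈ J ∧ b i ∈ J} : ℝ) := by
        rw [Finset.sum_congr rfl fun i _ => hmin i, Finset.sum_add_distrib, ← Finset.mul_sum,
          Finset.sum_boole]
      rw [hleft, hright]
      exact add_le_add (ih w' hw') (mul_le_mul_of_nonneg_left (hJ J) (sub_nonneg.2 hlt.le))

variable [DecidableEq ι]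

/-- The exponent vector obtained by choosing `a i` for `i ∈ t` and `b i` for `i ∈ s \ t`. -/
noncomputable def choiceVector (s t : Finset ι) (a b : ι → σ) : σ →₀ ℕ :=
  ∑ i ∈ t, Finsupp.single (a i) 1 + ∑ i ∈ s \ t, Finsupp.single (b i) 1


theorem sum_mul_choiceVector [Fintype σ] {R : Type*} [CommSemiring R] (s t : Finset ι)
    (a b : ι → σ) (w : σ → R) :
    ∑ v, w v * (choiceVector s t a b v : R) = ∑ i ∈ t, w (a i) + ∑ i ∈ s \ t, w (b i) := by
  simp only [choiceVector, Finsupp.add_apply, Finsupp.finsetSum_apply, Finsupp.single_apply,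
    Nat.cast_add, Nat.cast_sum, Nat.cast_ite, Nat.cast_one, Nat.cast_zero, mul_add,
    Finset.sum_add_distrib, Finset.mul_sum]
  congr 1 <;> rw [Finset.sum_comm] <;> simp

theorem mem_support_prod_X_add_X (s : Finset ι) (a b : ι → σ) (m : σ →₀ ℕ) :
    m ∈ (∏ i ∈ s, ((X (a i) : MvPolynomial σ ℤ) + X (b i))).support ↔
      ∃ t ⊆ s, choiceVector s t a b = m := by
  have hprod : ∏ i ∈ s, ((X (a i) : MvPolynomial σ ℤ) + X (b i)) =
      ∑ t ∈ s.powerset, monomial (choiceVector s t a b) 1 := by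
    rw [Finset.prod_add]
    refine Finset.sum_congr rfl fun t _ => ?_
    have h (u : Finset ι) (c : ι → σ) : ∏ i ∈ u, (X (c i) : MvPolynomial σ ℤ) =
        monomial (∑ i ∈ u, Finsupp.single (c i) 1) 1 := by
      rw [monomial_sum_one]; rfl
    rw [h, h, monomial_mul, one_mul, choiceVector]
  rw [mem_support_iff, hprod, coeff_sum]
  simp only [coeff_monomial, Finset.sum_boole]
  simp [Finset.filter_eq_empty_iff]

/-- Hall's theorem in the form of Hakimi's criterion for degree sequences of orientations. -/
theorem exists_choice_of_card_le_sum [Fintype σ] (s : Finset ι) (a b : ι → σ) (x : σ → ℕ)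
    (hx : ∑ v, x v = #s)
    (hJ : ∀ J : Finset σ, #{i ∈ s | a i ∈ J ∧ b i ∈ J} ≤ ∑ v ∈ J, x v) :
    ∃ g : ι → σ, (∀ i ∈ s, g i = a i ∨ g i = b i) ∧ ∀ v, #{i ∈ s | g i = v} = x v := by
  let slots : s → Finset (Σ v, Fin (x v)) := fun i =>
    ({a i, b i} : Finset σ).sigma fun _ => univ
  obtain ⟨f, hf, hfs⟩ := (Finset.all_card_le_biUnion_card_iff_exists_injective slots).1 (by
    intro F
    have hF : F.biUnion slots =
        (F.biUnion fun i => ({a i, b i} : Finset σ)).sigma fun _ => univ := by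
      ext ⟨v, k⟩
      simp [slots]
    rw [hF, Finset.card_sigma]
    simp only [Finset.card_univ, Fintype.card_fin]
    refine le_trans ?_ (hJ _)
    rw [← Finset.card_map (Function.Embedding.subtype _)]
    refine Finset.card_le_card fun i hi => ?_
    obtain ⟨j, hj, rfl⟩ := Finset.mem_map.1 hi
    simp only [Finset.mem_filter, Finset.mem_biUnion]
    exact ⟨j.2, ⟨j, hj, by simp⟩, ⟨j, hj, by simp⟩⟩)
  have hle (v : σ) : #{i : s | (f i).1 = v} ≤ x v := by
    calc #{i : s | (f i).1 = v} ≤ #(({v} : Finset σ).sigma fun v => (univ : Finset (Fin (x v)))) :=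
          Finset.card_le_card_of_injOn f (by intro i hi; simpa using hi) hf.injOn
      _ = x v := by simp
  have heq : ∀ v ∈ univ, #{i : s | (f i).1 = v} = x v := by
    refine (Finset.sum_eq_sum_iff_of_le fun v _ => hle v).1 ?_
    rw [hx, ← Finset.card_eq_sum_card_fiberwise (fun _ _ => by simp)]
    simp
  refine ⟨fun i => if h : i ∈ s then (f ⟨i, h⟩).1 else a i, fun i hi => ?_, fun v => ?_⟩
  · simpa [hi, slots] using hfs ⟨i, hi⟩
  · rw [← heq v (mem_univ v), ← Finset.card_map (Function.Embedding.subtype _)]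
    congr 1
    ext i
    by_cases hi : i ∈ s <;> simp [hi]

theorem exists_choiceVector_eq_iff [Fintype σ] (s : Finset ι) (a b : ι → σ) (m : σ →₀ ℕ) :
    (∃ t ⊆ s, choiceVector s t a b = m) ↔
      ∑ v, m v = #s ∧ ∀ J : Finset σ, #{i ∈ s | a i ∈ J ∧ b i ∈ J} ≤ ∑ v ∈ J, m v := by
  constructor
  · rintro ⟨t, ht, rfl⟩
    constructor
    · have := sum_mul_choiceVector (R := ℕ) s t a b fun _ => 1
      simp only [one_mul, Nat.cast_id] at this
      rw [this, add_comm, Finset.sum_sdiff ht]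
      simp
    · intro J
      have := sum_mul_choiceVector (R := ℕ) s t a b fun v => if v ∈ J then 1 else 0
      simp only [ite_mul, one_mul, zero_mul, Nat.cast_id, Finset.sum_ite_mem,
        Finset.univ_inter] at this
      rw [this, Finset.card_filter, ← Finset.sum_sdiff ht, add_comm]
      gcongr with i hi i hi <;> split_ifs <;> simp_all
  · rintro ⟨hm, hJ⟩
    obtain ⟨g, hg, hgm⟩ := exists_choice_of_card_le_sum s a b m hm hJ
    refine ⟨{i ∈ s | g i = a i}, Finset.filter_subset _ _, ?_⟩
    ext v
    rw [← hgm v, Finset.card_filter, choiceVector,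
      ← Finset.sum_sdiff (Finset.filter_subset (fun i => g i = a i) s), add_comm]
    simp only [Finsupp.add_apply, Finsupp.finsetSum_apply, Finsupp.single_apply]
    congr 1 <;> refine Finset.sum_congr rfl fun i hi => ?_
    · have := hg i (by simp_all)
      have : g i = b i := by simp_all
      rw [this]
    · rw [(Finset.mem_filter.1 hi).2]

theorem convexHull_choiceVector [Fintype σ] (s : Finset ι) (a b : ι → σ) :
    convexHull ℝ {y : σ → ℝ | ∃ t ⊆ s, y = fun v => (choiceVector s t a b v : ℝ)} =
      {y | ∑ v, y v = (#s : ℝ) ∧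
        ∀ J : Finset σ, (#{i ∈ s | a i ∈ J ∧ b i ∈ J} : ℝ) ≤ ∑ v ∈ J, y v} := by
  apply Set.Subset.antisymm
  · refine convexHull_min ?_ ?_
    · rintro y ⟨t, ht, rfl⟩
      obtain ⟨h, hJ⟩ := (exists_choiceVector_eq_iff s a b _).1 ⟨t, ht, rfl⟩
      exact ⟨by beta_reduce; exact_mod_cast h, fun J => by beta_reduce; exact_mod_cast hJ J⟩
    · rintro y ⟨hy, hyJ⟩ z ⟨hz, hzJ⟩ α β hα hβ hαβ
      constructor
      · simp only [Pi.add_apply, Pi.smul_apply, smul_eq_mul, Finset.sum_add_distrib,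
          ← Finset.mul_sum, hy, hz]
        rw [← add_mul, hαβ, one_mul]
      · intro J
        simp only [Pi.add_apply, Pi.smul_apply, smul_eq_mul, Finset.sum_add_distrib,
          ← Finset.mul_sum]
        calc _ = α * (#{i ∈ s | a i ∈ J ∧ b i ∈ J} : ℝ) + β * #{i ∈ s | a i ∈ J ∧ b i ∈ J} := by
              rw [← add_mul, hαβ, one_mul]
          _ ≤ _ := add_le_add (mul_le_mul_of_nonneg_left (hyJ J) hα)
            (mul_le_mul_of_nonneg_left (hzJ J) hβ)
  · rintro y ⟨hy, hyJ⟩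
    by_contra hmem
    set S := {y : σ → ℝ | ∃ t ⊆ s, y = fun v => (choiceVector s t a b v : ℝ)}
    have hfin : S.Finite := by
      refine ((s.powerset.finite_toSet).image
        fun t => fun v => (choiceVector s t a b v : ℝ)).subset ?_
      rintro _ ⟨t, ht, rfl⟩
      exact ⟨t, by simpa using ht, rfl⟩
    obtain ⟨f, u, hfy, hfS⟩ := geometric_hahn_banach_point_closed (convex_convexHull ℝ S)
      (hfin.isCompact_convexHull ℝ).isClosed hmem
    have hf (z : σ → ℝ) : f z = ∑ v, f (Pi.single v 1) * z v := by
      have := LinearMap.pi_apply_eq_sum_univ (f : (σ → ℝ) →ₗ[ℝ] ℝ) z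
      simp only [ContinuousLinearMap.coe_coe, smul_eq_mul] at this
      rw [this]
      refine Finset.sum_congr rfl fun v _ => ?_
      rw [mul_comm]
      congr 2
      ext j
      simp [Pi.single_apply, eq_comm]
    set w : σ → ℝ := fun v => f (Pi.single v 1)
    let t : Finset ι := {i ∈ s | w (a i) ≤ w (b i)}
    have ht : t ⊆ s := Finset.filter_subset _ _
    have hz := hfS _ (subset_convexHull ℝ S ⟨t, ht, rfl⟩)
    rw [hf, sum_mul_choiceVector] at hz
    have hmin : ∑ i ∈ t, w (a i) + ∑ i ∈ s \ t, w (b i) = ∑ i ∈ s, min (w (a i)) (w (b i)) := by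
      rw [← Finset.sum_sdiff ht, add_comm]
      congr 1 <;> refine Finset.sum_congr rfl fun i hi => ?_
      · have : w (b i) ≤ w (a i) := by
          by_contra! h
          simp [t, h.le] at hi
        rw [min_eq_right this]
      · rw [min_eq_left (Finset.mem_filter.1 hi).2]
    rw [hmin] at hz
    rw [hf] at hfy
    exact absurd (sum_min_le_sum_mul s a b y hy hyJ w) (by linarith)

theorem isDiscretePolymatroid_choice [Fintype σ] (s : Finset ι) (a b : ι → σ) :
    IsDiscretePolymatroid {x : σ → ℕ | ∑ v, x v = #s ∧
      ∀ J : Finset σ, #{i ∈ s | a i ∈ J ∧ b i ∈ J} ≤ ∑ v ∈ J, x v} := by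
  have hcompl (J : Finset σ) :
      #{i ∈ s | a i ∈ J ∨ b i ∈ J} + #{i ∈ s | a i ∈ Jᶜ ∧ b i ∈ Jᶜ} = #s := by
    rw [← Finset.card_filter_add_card_filter_not (s := s) fun i => a i ∈ J ∨ b i ∈ J]
    simp only [Finset.mem_compl, not_or]
  refine ⟨fun J => #{i ∈ s | a i ∈ J ∨ b i ∈ J}, by simp, fun J₁ J₂ h => ?_, fun J₁ J₂ => ?_, ?_⟩
  · exact Finset.card_le_card (Finset.monotone_filter_right s fun i _ => Or.imp (@h _) (@h _))
  · rw [add_comm, ← Finset.card_union_add_card_inter {i ∈ s | a i ∈ J₁ ∨ b i ∈ J₁}]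
    refine add_le_add (Finset.card_le_card fun i => ?_) (Finset.card_le_card fun i => ?_) <;>
    · simp only [Finset.mem_filter, Finset.mem_union, Finset.mem_inter]
      tauto
  · ext x
    simp only [Set.mem_ofPred_eq, Finset.mem_univ, or_self, Finset.filter_true]
    constructor
    · rintro ⟨hx, hJ⟩
      refine ⟨fun J _ => ?_, hx⟩
      have h1 := hJ Jᶜ
      have h2 := hcompl J
      have h3 := Finset.sum_add_sum_compl J x
      omega
    · rintro ⟨hJ, hx⟩
      refine ⟨hx, fun J => ?_⟩
      rcases J.eq_empty_or_nonempty with rfl | hne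
      · simp
      · have h1 := hJ Jᶜ (by
          rw [Finset.ssubset_univ_iff, Ne, Finset.compl_eq_univ_iff]
          exact hne.ne_empty)
        have h2 := hcompl Jᶜ
        have h3 := Finset.sum_add_sum_compl J x
        rw [compl_compl] at h2
        omega

end Orientation

/-- For `g = ∏_{(i,j) ∈ L} (t_i + s_j)`: the Newton polytope of `g` is the set of
nonnegative points `(r,c)` with `∑ r + ∑ c = |L|` and
`∑_{i ∈ J₁} r_i + ∑_{j ∈ J₂} c_j ≥ |{(i,j) ∈ L : i ∈ J₁, j ∈ J₂}|` for all
`J₁, J₂ ⊆ [p]`; the support of `g` consists exactly of the lattice points of this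
polytope; and hence the support of `g` is a discrete polymatroid on `[2p]`.
Here the variable `X (Sum.inl i)` is `t_{i+1}` and `X (Sum.inr j)` is `s_{j+1}`. -/
theorem newtonPolytope_prod_ts (p : ℕ) (hp : 1 ≤ p) (L : Finset (Fin p × Fin p)) :
    convexHull ℝ {y : (Fin p ⊕ Fin p) → ℝ |
        ∃ m ∈ (∏ q ∈ L, ((X (Sum.inl q.1) : MvPolynomial (Fin p ⊕ Fin p) ℤ) +
            X (Sum.inr q.2))).support,
          y = fun v => (m v : ℝ)} =
      {y : (Fin p ⊕ Fin p) → ℝ |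
        (∀ v, 0 ≤ y v) ∧
        (∑ v : Fin p ⊕ Fin p, y v) = (L.card : ℝ) ∧
        ∀ J₁ J₂ : Finset (Fin p),
          ((L.filter fun q => q.1 ∈ J₁ ∧ q.2 ∈ J₂).card : ℝ) ≤
            (∑ i ∈ J₁, y (Sum.inl i)) + ∑ j ∈ J₂, y (Sum.inr j)} ∧
    (∀ x : (Fin p ⊕ Fin p) →₀ ℕ,
      x ∈ (∏ q ∈ L, ((X (Sum.inl q.1) : MvPolynomial (Fin p ⊕ Fin p) ℤ) +
            X (Sum.inr q.2))).support ↔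
        (∀ v, (0:ℝ) ≤ (x v : ℝ)) ∧
        (∑ v : Fin p ⊕ Fin p, (x v : ℝ)) = (L.card : ℝ) ∧
        ∀ J₁ J₂ : Finset (Fin p),
          ((L.filter fun q => q.1 ∈ J₁ ∧ q.2 ∈ J₂).card : ℝ) ≤
            (∑ i ∈ J₁, (x (Sum.inl i) : ℝ)) + ∑ j ∈ J₂, (x (Sum.inr j) : ℝ)) ∧
    IsDiscretePolymatroid
      ((fun m : (Fin p ⊕ Fin p) →₀ ℕ => (m : (Fin p ⊕ Fin p) → ℕ)) ''
        ((∏ q ∈ L, ((X (Sum.inl q.1) : MvPolynomial (Fin p ⊕ Fin p) ℤ) +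
            X (Sum.inr q.2))).support : Set ((Fin p ⊕ Fin p) →₀ ℕ))) := by
  have hsum (y : Fin p ⊕ Fin p → ℝ) :
      ((∀ v, 0 ≤ y v) ∧ (∑ v, y v) = (L.card : ℝ) ∧ ∀ J₁ J₂ : Finset (Fin p),
        ((L.filter fun q => q.1 ∈ J₁ ∧ q.2 ∈ J₂).card : ℝ) ≤
          (∑ i ∈ J₁, y (Sum.inl i)) + ∑ j ∈ J₂, y (Sum.inr j)) ↔
      (∑ v, y v) = (L.card : ℝ) ∧ ∀ J : Finset (Fin p ⊕ Fin p),
        ((L.filter fun q => Sum.inl q.1 ∈ J ∧ Sum.inr q.2 ∈ J).card : ℝ) ≤ ∑ v ∈ J, y v := by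
    constructor
    · rintro ⟨-, hy, hJ⟩
      refine ⟨hy, fun J => ?_⟩
      have := hJ J.toLeft J.toRight
      rw [← Finset.sum_disjSum, Finset.toLeft_disjSum_toRight] at this
      simpa using this
    · rintro ⟨hy, hJ⟩
      refine ⟨fun v => ?_, hy, fun J₁ J₂ => ?_⟩
      · simpa using (Nat.cast_nonneg _).trans (hJ {v})
      · simpa [Finset.sum_disjSum] using hJ (J₁.disjSum J₂)
  have hsupp (x : (Fin p ⊕ Fin p) →₀ ℕ) :=
    mem_support_prod_X_add_X L (fun q => Sum.inl q.1) (fun q => Sum.inr q.2) x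
  refine ⟨?_, fun x => ?_, ?_⟩
  · simp only [hsupp, hsum]
    rw [← convexHull_choiceVector L (fun q => Sum.inl q.1) (fun q => Sum.inr q.2)]
    congr 1
    ext y
    simp
  · rw [hsum fun v => (x v : ℝ), hsupp, exists_choiceVector_eq_iff]
    norm_cast
  · convert isDiscretePolymatroid_choice L (fun q => (Sum.inl q.1 : Fin p ⊕ Fin p))
      (fun q => Sum.inr q.2) using 1
    ext x
    simp only [Set.mem_image, Finset.mem_coe, hsupp, exists_choiceVector_eq_iff, Set.mem_ofPred_eq]
    constructor
    · rintro ⟨m, hm, rfl⟩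
      exact hm
    · intro hx
      exact ⟨Finsupp.equivFunOnFinite.symm x, by simpa using hx, by ext v; simp⟩
end
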